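/- arXiv:2011.01418 — 3 statements merged into one kernel-verified Lean document; each statement's English description precedes it below -/
import Mathlib

section
/- Let 2 ≤ k ≤ d, m ≥ 1, α ∈ (0,1), λ > 0, and 0 ≤ ε ≤ 2/3, and let D̂_t be any finite dataset of points in ℝ^d × ℝ. Then every (θ_s, θ_t, φ) satisfying L_{D_t}(θ_t, φ) ≤ ε obeys the lower bound L_joint^λ(θ_s, θ_t, φ) ≥ min_{μ∈ℝ} [ (3λ/2^{4/3})·|μ|^{2/3} + (2/3)(1−α)(μ−1)^2 ] + (3λ/2^{4/3})·(1 − √(3ε/2))^{2/3}. -/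
open MeasureTheory Finset

noncomputable section

/-- Uniform measure on `{-1, 0, 1} ⊆ ℝ`. -/
def unif3 : Measure ℝ :=
  (PMF.uniformOfFinset ({-1, 0, 1} : Finset ℝ) (by norm_num)).toMeasure

/-- Uniform measure on `{-1, 1} ⊆ ℝ`. -/
def unif2 : Measure ℝ :=
  (PMF.uniformOfFinset ({-1, 1} : Finset ℝ) (by norm_num)).toMeasure

/-- Distribution of `x` conditioned on `y = 0` under the source distribution `D_s^(k)`. -/
def srcBranch0 (d k : ℕ) : Measure (Fin d → ℝ) :=
  Measure.pi (fun i => if (i : ℕ) < k then Measure.dirac (0 : ℝ) else unif3)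

/-- Distribution of `x` conditioned on `y = 1` under the source distribution `D_s^(k)`. -/
def srcBranch1 (d k : ℕ) : Measure (Fin d → ℝ) :=
  Measure.pi (fun i => if (i : ℕ) < k then unif2 else unif3)

/-- The source distribution `D_s^(k)` on `ℝ^d × ℝ`. -/
def sourceMeasure (d k : ℕ) : Measure ((Fin d → ℝ) × ℝ) :=
  (1/3 : ENNReal) • (srcBranch0 d k).map (fun x => (x, (0 : ℝ)))
    + (2/3 : ENNReal) • (srcBranch1 d k).map (fun x => (x, (1 : ℝ)))

/-- The target distribution `D_t = D_s^(1)`. -/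
def targetMeasure (d : ℕ) : Measure ((Fin d → ℝ) × ℝ) := sourceMeasure d 1

/-- The two-layer quadratic network `f_{θ,φ}(x) = ∑ i, θ i (w_i ⬝ x)^2`,
where `w_i` is the `i`-th column of `φ`. -/
def qnet {d m : ℕ} (θ : Fin m → ℝ) (φ : Matrix (Fin d) (Fin m) ℝ) (x : Fin d → ℝ) : ℝ :=
  ∑ i, θ i * (∑ j, φ j i * x j) ^ 2

/-- Population squared loss on the distribution `D`. -/
def popLoss {d m : ℕ} (D : Measure ((Fin d → ℝ) × ℝ)) (θ : Fin m → ℝ)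
    (φ : Matrix (Fin d) (Fin m) ℝ) : ℝ :=
  ∫ p, (qnet θ φ p.1 - p.2) ^ 2 ∂D

/-- Empirical squared loss on the dataset `S`. -/
def empLoss {d m n : ℕ} (S : Fin n → (Fin d → ℝ) × ℝ) (θ : Fin m → ℝ)
    (φ : Matrix (Fin d) (Fin m) ℝ) : ℝ :=
  (1 / (n : ℝ)) * ∑ i, (qnet θ φ (S i).1 - (S i).2) ^ 2

/-- Squared Frobenius norm of the feature extractor. -/
def frobSq {d m : ℕ} (φ : Matrix (Fin d) (Fin m) ℝ) : ℝ := ∑ j, ∑ i, (φ j i) ^ 2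

/-- Squared Euclidean norm of a head. -/
def normSq {m : ℕ} (θ : Fin m → ℝ) : ℝ := ∑ i, (θ i) ^ 2

/-- The regularized joint training objective `L_joint^λ`. -/
def jointObj {d m n : ℕ} (k : ℕ) (α lam : ℝ) (S : Fin n → (Fin d → ℝ) × ℝ)
    (θs θt : Fin m → ℝ) (φ : Matrix (Fin d) (Fin m) ℝ) : ℝ :=
  (1 - α) * popLoss (sourceMeasure d k) θs φ + α * empLoss S θt φ
    + lam * (normSq θs + normSq θt + frobSq φ)

end

instance unif3_prob : IsProbabilityMeasure unif3 := by
  unfold unif3; infer_instance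

instance unif2_prob : IsProbabilityMeasure unif2 := by
  unfold unif2; infer_instance

lemma ae_unifFinset (s : Finset ℝ) (hs : s.Nonempty) :
    ∀ᵐ x ∂(PMF.uniformOfFinset s hs).toMeasure, x ∈ s := by
  rw [ae_iff, PMF.toMeasure_apply_eq_zero_iff _ (by measurability)]
  rw [Set.disjoint_left]
  intro a ha
  simpa using ha

/-- A nice one-dimensional law: supported in `[-1,1]`. -/
lemma unif3_mem : ∀ᵐ x ∂unif3, x ∈ Set.Icc (-1 : ℝ) 1 := by
  unfold unif3
  filter_upwards [ae_unifFinset _ _] with x hx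
  simp at hx
  rcases hx with h | h | h <;> subst h <;> norm_num

lemma unif2_mem : ∀ᵐ x ∂unif2, x ∈ Set.Icc (-1 : ℝ) 1 := by
  unfold unif2
  filter_upwards [ae_unifFinset _ _] with x hx
  simp at hx
  rcases hx with h | h <;> subst h <;> norm_num

lemma integrable_of_ae_compact {X : Type*} [TopologicalSpace X] [T2Space X] [MeasurableSpace X]
    [OpensMeasurableSpace X]
    {P : Measure X} [IsFiniteMeasure P] {K : Set X} (hK : IsCompact K) (hP : ∀ᵐ x ∂P, x ∈ K)
    {g : X → ℝ} (hg : Continuous g) : Integrable g P := by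
  have h : IntegrableOn g K P := hg.continuousOn.integrableOn_compact hK
  rwa [IntegrableOn, Measure.restrict_eq_self_of_ae_mem hP] at h

lemma unif3_mean : ∫ x, x ∂unif3 = 0 := by
  have hi : Integrable (fun x : ℝ => x) unif3 :=
    integrable_of_ae_compact isCompact_Icc unif3_mem continuous_id
  unfold unif3 at hi ⊢
  rw [PMF.integral_eq_tsum _ _ hi, tsum_eq_sum (s := ({-1, 0, 1} : Finset ℝ))]
  · rw [Finset.sum_insert (by norm_num), Finset.sum_insert (by norm_num), Finset.sum_singleton]
    simp
  · intro b hb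
    rw [PMF.uniformOfFinset_apply_of_notMem _ hb]; simp

lemma unif2_mean : ∫ x, x ∂unif2 = 0 := by
  have hi : Integrable (fun x : ℝ => x) unif2 :=
    integrable_of_ae_compact isCompact_Icc unif2_mem continuous_id
  unfold unif2 at hi ⊢
  rw [PMF.integral_eq_tsum _ _ hi, tsum_eq_sum (s := ({-1, 1} : Finset ℝ))]
  · rw [Finset.sum_insert (by norm_num), Finset.sum_singleton]
    simp
  · intro b hb
    rw [PMF.uniformOfFinset_apply_of_notMem _ hb]; simp

lemma pi_mem {d : ℕ} (P : Fin d → Measure ℝ) [∀ i, IsProbabilityMeasure (P i)]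
    (h : ∀ i, ∀ᵐ x ∂(P i), x ∈ Set.Icc (-1 : ℝ) 1) :
    ∀ᵐ x ∂(Measure.pi P), x ∈ Set.Icc (fun _ : Fin d => (-1 : ℝ)) (fun _ => 1) := by
  have : ∀ i, ∀ᵐ x ∂(Measure.pi P), x i ∈ Set.Icc (-1 : ℝ) 1 := fun i =>
    (Measure.quasiMeasurePreserving_eval (μ := P) i).ae (h i)
  filter_upwards [ae_all_iff.2 this] with x hx
  exact ⟨fun i => (hx i).1, fun i => (hx i).2⟩

lemma pi_second_moment {d : ℕ} (P : Fin d → Measure ℝ) [∀ i, IsProbabilityMeasure (P i)]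
    (h : ∀ i, ∀ᵐ x ∂(P i), x ∈ Set.Icc (-1 : ℝ) 1) (h0 : ∀ i, ∫ x, x ∂(P i) = 0)
    (w : Fin d → ℝ) :
    ∫ x, (∑ j, w j * x j) ^ 2 ∂(Measure.pi P) ≤ ∑ j, (w j) ^ 2 := by
  have hK := pi_mem P h
  have hint : ∀ {g : (Fin d → ℝ) → ℝ}, Continuous g → Integrable g (Measure.pi P) :=
    fun hg => integrable_of_ae_compact isCompact_Icc hK hg
  have hint1 : ∀ i, ∀ {g : ℝ → ℝ}, Continuous g → Integrable g (P i) :=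
    fun i _ hg => integrable_of_ae_compact isCompact_Icc (h i) hg
  have hL : ∀ i, MemLp (fun x : ℝ => w i * x) 2 (P i) := fun i =>
    (memLp_two_iff_integrable_sq (by fun_prop)).2 (hint1 i (by fun_prop))
  have hv := ProbabilityTheory.variance_sum_pi (μ := P) (X := fun i x => w i * x) hL
  have e : (∑ i, fun ω : Fin d → ℝ => w i * ω i) = fun ω => ∑ i, w i * ω i := by
    ext ω; simp
  rw [e, ProbabilityTheory.variance_eq_sub
    ((memLp_two_iff_integrable_sq (hint (by fun_prop)).aestronglyMeasurable).2
      (hint (by fun_prop)))] at hv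
  have hm : ∫ x, (∑ j, w j * x j) ∂(Measure.pi P) = 0 := by
    rw [integral_finsetSum _ (fun i _ => hint (by fun_prop))]
    refine Finset.sum_eq_zero fun i _ => ?_
    have := integral_comp_eval (μ := P) (i := i) (f := fun x : ℝ => w i * x)
      (by fun_prop)
    rw [this, integral_const_mul, h0, mul_zero]
  rw [hm] at hv
  have hv' : ∫ x, (∑ j, w j * x j) ^ 2 ∂(Measure.pi P)
      = ∑ i, ProbabilityTheory.variance (fun x => w i * x) (P i) := by
    rw [← hv]; simp
  rw [hv']
  refine Finset.sum_le_sum fun i _ => ?_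
  refine (ProbabilityTheory.variance_le_expectation_sq (by fun_prop)).trans ?_
  have : ∫ x, ((fun x => w i * x) ^ 2) x ∂(P i) ≤ ∫ x, (w i) ^ 2 ∂(P i) := by
    refine integral_mono_ae (hint1 i (by fun_prop)) (integrable_const _) ?_
    filter_upwards [h i] with x hx
    have : x ^ 2 ≤ 1 := by nlinarith [hx.1, hx.2]
    simp only [Pi.pow_apply, mul_pow]
    nlinarith [sq_nonneg (w i)]
  simpa using this

lemma qnet_continuous {d m : ℕ} (θ : Fin m → ℝ) (φ : Matrix (Fin d) (Fin m) ℝ) :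
    Continuous (qnet θ φ) := by
  unfold qnet; fun_prop

lemma src_key (d k : ℕ) {m : ℕ} (θ : Fin m → ℝ) (φ : Matrix (Fin d) (Fin m) ℝ) :
    ∃ μ : ℝ, (2 / 3) * (μ - 1) ^ 2 ≤ popLoss (sourceMeasure d k) θ φ ∧
      μ ^ 2 ≤ normSq θ * frobSq φ ^ 2 := by
  have inst0 : ∀ i : Fin d, IsProbabilityMeasure
      (if (i : ℕ) < k then Measure.dirac (0 : ℝ) else unif3) := by
    intro i; split_ifs <;> infer_instance
  have inst1 : ∀ i : Fin d, IsProbabilityMeasure (if (i : ℕ) < k then unif2 else unif3) := by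
    intro i; split_ifs <;> infer_instance
  have m0 : ∀ i : Fin d, ∀ᵐ x ∂(if (i : ℕ) < k then Measure.dirac (0 : ℝ) else unif3),
      x ∈ Set.Icc (-1 : ℝ) 1 := by
    intro i; split_ifs
    · exact (ae_dirac_iff (p := fun x : ℝ => x ∈ Set.Icc (-1 : ℝ) 1) measurableSet_Icc).2 (by norm_num)
    · exact unif3_mem
  have m1 : ∀ i : Fin d, ∀ᵐ x ∂(if (i : ℕ) < k then unif2 else unif3),
      x ∈ Set.Icc (-1 : ℝ) 1 := by
    intro i; split_ifs
    · exact unif2_mem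
    · exact unif3_mem
  have z1 : ∀ i : Fin d, ∫ x, x ∂(if (i : ℕ) < k then unif2 else unif3) = 0 := by
    intro i; split_ifs
    · exact unif2_mean
    · exact unif3_mean
  have p0 : IsProbabilityMeasure (srcBranch0 d k) := by unfold srcBranch0; infer_instance
  have p1 : IsProbabilityMeasure (srcBranch1 d k) := by unfold srcBranch1; infer_instance
  have hint0 : ∀ {g : (Fin d → ℝ) → ℝ}, Continuous g → Integrable g (srcBranch0 d k) :=
    fun hg => integrable_of_ae_compact isCompact_Icc (pi_mem _ m0) hg
  have hint1 : ∀ {g : (Fin d → ℝ) → ℝ}, Continuous g → Integrable g (srcBranch1 d k) :=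
    fun hg => integrable_of_ae_compact isCompact_Icc (pi_mem _ m1) hg
  have hq := qnet_continuous θ φ
  refine ⟨∫ x, qnet θ φ x ∂(srcBranch1 d k), ?_, ?_⟩
  · set c := ∫ x, qnet θ φ x ∂(srcBranch1 d k) with hc
    have hcont : Continuous fun p : (Fin d → ℝ) × ℝ => (qnet θ φ p.1 - p.2) ^ 2 := by
      fun_prop
    have e0 : AEMeasurable (fun x : Fin d → ℝ => (x, (0 : ℝ))) (srcBranch0 d k) := by fun_prop
    have e1 : AEMeasurable (fun x : Fin d → ℝ => (x, (1 : ℝ))) (srcBranch1 d k) := by fun_prop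
    have i0 : Integrable (fun p : (Fin d → ℝ) × ℝ => (qnet θ φ p.1 - p.2) ^ 2)
        ((srcBranch0 d k).map (fun x => (x, (0 : ℝ)))) := by
      rw [integrable_map_measure hcont.aestronglyMeasurable e0]
      exact hint0 (by fun_prop)
    have i1 : Integrable (fun p : (Fin d → ℝ) × ℝ => (qnet θ φ p.1 - p.2) ^ 2)
        ((srcBranch1 d k).map (fun x => (x, (1 : ℝ)))) := by
      rw [integrable_map_measure hcont.aestronglyMeasurable e1]
      exact hint1 (by fun_prop)
    unfold popLoss sourceMeasure
    have t1 : (1 / 3 : ENNReal) ≠ ⊤ := (ENNReal.div_lt_top (by simp) (by simp)).ne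
    have t2 : (2 / 3 : ENNReal) ≠ ⊤ := (ENNReal.div_lt_top (by simp) (by simp)).ne
    rw [integral_add_measure (i0.smul_measure t1) (i1.smul_measure t2),
      integral_smul_measure, integral_smul_measure,
      integral_map e1 hcont.aestronglyMeasurable]
    have n0 : 0 ≤ ∫ p, (qnet θ φ p.1 - p.2) ^ 2 ∂((srcBranch0 d k).map (fun x => (x, (0 : ℝ)))) :=
      integral_nonneg fun p => sq_nonneg _
    have hJ : (c - 1) ^ 2 ≤ ∫ x, (qnet θ φ x - 1) ^ 2 ∂(srcBranch1 d k) := by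
      have : ∫ x, (2 * (c - 1) * qnet θ φ x - (c ^ 2 - 1)) ∂(srcBranch1 d k)
          ≤ ∫ x, (qnet θ φ x - 1) ^ 2 ∂(srcBranch1 d k) := by
        refine integral_mono (hint1 (by fun_prop)) (hint1 (by fun_prop)) fun x => ?_
        simp only
        nlinarith [sq_nonneg (qnet θ φ x - c)]
      rw [integral_sub (hint1 (by fun_prop)) (integrable_const _), integral_const_mul, ← hc] at this
      simp at this
      nlinarith
    have r1 : (1 / 3 : ENNReal).toReal = 1 / 3 := by simp
    have r2 : (2 / 3 : ENNReal).toReal = 2 / 3 := by simp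
    rw [r1, r2, smul_eq_mul, smul_eq_mul]
    simp only
    nlinarith
  · have hE : ∫ x, qnet θ φ x ∂(srcBranch1 d k)
        = ∑ i, θ i * ∫ x, (∑ j, φ j i * x j) ^ 2 ∂(srcBranch1 d k) := by
      unfold qnet
      rw [integral_finsetSum _ (fun i _ => hint1 (by fun_prop))]
      exact Finset.sum_congr rfl fun i _ => integral_const_mul _ _
    rw [hE]
    set E : Fin m → ℝ := fun i => ∫ x, (∑ j, φ j i * x j) ^ 2 ∂(srcBranch1 d k) with hEdef
    have E0 : ∀ i, 0 ≤ E i := fun i => integral_nonneg fun x => sq_nonneg _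
    have E1 : ∀ i, E i ≤ ∑ j, (φ j i) ^ 2 := fun i =>
      pi_second_moment _ m1 z1 (fun j => φ j i)
    have hN : 0 ≤ normSq θ := Finset.sum_nonneg fun i _ => sq_nonneg _
    have hF : ∑ i, E i ≤ frobSq φ := by
      unfold frobSq
      rw [Finset.sum_comm]
      exact Finset.sum_le_sum fun i _ => E1 i
    have hS : 0 ≤ ∑ i, E i := Finset.sum_nonneg fun i _ => E0 i
    calc (∑ i, θ i * E i) ^ 2 ≤ (∑ i, θ i ^ 2) * (∑ i, E i ^ 2) :=
          Finset.sum_mul_sq_le_sq_mul_sq _ _ _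
      _ ≤ normSq θ * (∑ i, E i) ^ 2 :=
          mul_le_mul_of_nonneg_left (Finset.sum_sq_le_sq_sum_of_nonneg fun i _ => E0 i) hN
      _ ≤ normSq θ * frobSq φ ^ 2 := by gcongr

lemma num_key (N F μ : ℝ) (hN : 0 ≤ N) (hF : 0 ≤ F) (h : μ ^ 2 ≤ N * F ^ 2) :
    3 / (2 : ℝ) ^ ((4 : ℝ) / 3) * |μ| ^ ((2 : ℝ) / 3) ≤ N + F / 2 := by
  have ha : ((2 : ℝ) ^ ((4 : ℝ) / 3)) ^ 3 = 16 := by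
    rw [← Real.rpow_natCast, ← Real.rpow_mul (by norm_num)]; norm_num
  have hb : (|μ| ^ ((2 : ℝ) / 3)) ^ 3 = μ ^ 2 := by
    rw [← Real.rpow_natCast, ← Real.rpow_mul (abs_nonneg _)]; norm_num
  refine le_of_pow_le_pow_left₀ (n := 3) (by norm_num) (by positivity) ?_
  rw [mul_pow, div_pow, ha, hb]
  nlinarith [mul_nonneg (sq_nonneg (N - F / 4)) (by positivity : 0 ≤ N + 2 * F)]

/-- Lemma 1: any solution whose target population loss is at most `ε` has joint training
objective bounded below by
`min_μ [ (3λ/2^{4/3})|μ|^{2/3} + (2/3)(1-α)(μ-1)² ] + (3λ/2^{4/3})(1 - √(3ε/2))^{2/3}`. -/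
theorem jointObj_lower_bound (d k m n : ℕ) (h2 : 2 ≤ k) (hkd : k ≤ d) (hm : 1 ≤ m)
    (α lam ε : ℝ) (hα0 : 0 < α) (hα1 : α < 1) (hlam : 0 < lam)
    (hε0 : 0 ≤ ε) (hε1 : ε ≤ 2 / 3)
    (S : Fin n → (Fin d → ℝ) × ℝ)
    (θs θt : Fin m → ℝ) (φ : Matrix (Fin d) (Fin m) ℝ)
    (hloss : popLoss (targetMeasure d) θt φ ≤ ε) :
    jointObj k α lam S θs θt φ ≥
      sInf (Set.range fun μ : ℝ =>
          (3 * lam / (2 : ℝ) ^ ((4 : ℝ) / 3)) * |μ| ^ ((2 : ℝ) / 3)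
            + (2 / 3) * (1 - α) * (μ - 1) ^ 2)
        + (3 * lam / (2 : ℝ) ^ ((4 : ℝ) / 3))
            * (1 - Real.sqrt (3 * ε / 2)) ^ ((2 : ℝ) / 3) := by
  obtain ⟨μ, hμ1, hμ2⟩ := src_key d k θs φ
  obtain ⟨ν, hν1, hν2⟩ := src_key d 1 θt φ
  have hNs : 0 ≤ normSq θs := Finset.sum_nonneg fun i _ => sq_nonneg _
  have hNt : 0 ≤ normSq θt := Finset.sum_nonneg fun i _ => sq_nonneg _
  have hF : 0 ≤ frobSq φ := Finset.sum_nonneg fun j _ => Finset.sum_nonneg fun i _ => sq_nonneg _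
  have hs := num_key _ _ μ hNs hF hμ2
  have ht := num_key _ _ ν hNt hF hν2
  have hemp : 0 ≤ empLoss S θt φ :=
    mul_nonneg (by positivity) (Finset.sum_nonneg fun i _ => sq_nonneg _)
  have hν3 : (2 / 3) * (ν - 1) ^ 2 ≤ ε := hν1.trans hloss
  have hν4 : 1 - ν ≤ Real.sqrt (3 * ε / 2) := Real.le_sqrt_of_sq_le (by nlinarith)
  have hsq : Real.sqrt (3 * ε / 2) ≤ 1 := Real.sqrt_le_one.2 (by linarith)
  have hmono : (1 - Real.sqrt (3 * ε / 2)) ^ ((2 : ℝ) / 3) ≤ |ν| ^ ((2 : ℝ) / 3) :=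
    Real.rpow_le_rpow (by linarith) (by linarith [le_abs_self ν]) (by norm_num)
  have hinf : sInf (Set.range fun μ : ℝ =>
          (3 * lam / (2 : ℝ) ^ ((4 : ℝ) / 3)) * |μ| ^ ((2 : ℝ) / 3)
            + (2 / 3) * (1 - α) * (μ - 1) ^ 2) ≤
      (3 * lam / (2 : ℝ) ^ ((4 : ℝ) / 3)) * |μ| ^ ((2 : ℝ) / 3)
            + (2 / 3) * (1 - α) * (μ - 1) ^ 2 := by
    refine csInf_le ⟨0, ?_⟩ ⟨μ, rfl⟩
    rintro _ ⟨x, rfl⟩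
    have : 0 ≤ 1 - α := by linarith
    positivity
  set C : ℝ := (2 : ℝ) ^ ((4 : ℝ) / 3) with hC
  have hC0 : 0 < C := by positivity
  have e : 3 * lam / C = lam * (3 / C) := by ring
  rw [e] at hinf ⊢
  have h3 : 3 / C * (1 - Real.sqrt (3 * ε / 2)) ^ ((2 : ℝ) / 3) ≤ normSq θt + frobSq φ / 2 :=
    (mul_le_mul_of_nonneg_left hmono (by positivity)).trans ht
  have g1 := mul_le_mul_of_nonneg_left hs hlam.le
  have g2 := mul_le_mul_of_nonneg_left h3 hlam.le
  have g3 := mul_le_mul_of_nonneg_left hμ1 (by linarith : 0 ≤ 1 - α)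
  have g4 := mul_nonneg hα0.le hemp
  unfold jointObj
  nlinarith
end

section
/- Let 2 ≤ k ≤ d, m ≥ 2, α ∈ (0,1) and λ > 0. Let D̂_t = {(x_i^t, y_i^t)}_{i=1}^{n_t} be a dataset with y_i^t = (x^t_{i[1]})^2 for all i, and suppose there exists a vector φ̂_t ∈ ℝ^d with ⟨φ̂_t, x_i^t⟩ = x^t_{i[1]} for all i ∈ [n_t]. Then there exists a solution (θ_s, θ_t, φ) such that L_joint^λ(θ_s, θ_t, φ) ≤ min_{μ∈ℝ} [ (3λ/2^{2/3})·|μ|^{2/3} + (2/3)(1−α)(μ−1)^2 ] + (3λ/2^{2/3})·‖φ̂_t‖_2^{4/3}. -/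
open MeasureTheory Finset

lemma aux_cost (μ : ℝ) : ∃ θ a : ℝ, θ * a ^ 2 = μ ∧
    θ ^ 2 + a ^ 2 = 3 / (2 : ℝ) ^ ((2 : ℝ) / 3) * |μ| ^ ((2 : ℝ) / 3) := by
  by_cases hμ : μ = 0
  · refine ⟨0, 0, by simp [hμ], ?_⟩
    rw [hμ, abs_zero, Real.zero_rpow (by norm_num)]
    simp
  · set s : ℝ := |μ| ^ ((1 : ℝ) / 3) with hs
    set r : ℝ := (2 : ℝ) ^ ((1 : ℝ) / 3) with hr
    have hμp : 0 < |μ| := abs_pos.mpr hμ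
    have hsp : 0 < s := Real.rpow_pos_of_pos hμp _
    have hrp : 0 < r := Real.rpow_pos_of_pos (by norm_num) _
    have hs3 : s ^ 3 = |μ| := by
      rw [hs, ← Real.rpow_natCast, ← Real.rpow_mul hμp.le]; norm_num
    have hr3 : r ^ 3 = 2 := by
      rw [hr, ← Real.rpow_natCast, ← Real.rpow_mul (by norm_num)]; norm_num
    have hs2 : |μ| ^ ((2 : ℝ) / 3) = s ^ 2 := by
      rw [hs, ← Real.rpow_natCast, ← Real.rpow_mul hμp.le]; norm_num
    have hr2 : (2 : ℝ) ^ ((2 : ℝ) / 3) = r ^ 2 := by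
      rw [hr, ← Real.rpow_natCast, ← Real.rpow_mul (by norm_num)]; norm_num
    rw [hs2, hr2]
    have hsq : Real.sqrt (r * s ^ 2) ^ 2 = r * s ^ 2 := Real.sq_sqrt (by positivity)
    have h6 : μ ^ 2 = s ^ 6 := by
      rw [← sq_abs, ← hs3]; ring
    refine ⟨μ / (r * s ^ 2), Real.sqrt (r * s ^ 2), ?_, ?_⟩
    · rw [hsq]; field_simp
    · rw [hsq, div_pow, h6]
      field_simp
      linear_combination hr3

instance : IsProbabilityMeasure unif3 := by unfold unif3; infer_instance
instance : IsProbabilityMeasure unif2 := by unfold unif2; infer_instance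

lemma unif2_ae : ∀ᵐ x ∂unif2, x ^ 2 = 1 := by
  have hm : MeasurableSet {x : ℝ | ¬ x ^ 2 = 1} :=
    (measurableSet_eq_fun (by fun_prop) (by fun_prop)).compl
  rw [ae_iff, unif2, PMF.toMeasure_apply_eq_zero_iff _ hm, PMF.support_uniformOfFinset,
    Set.disjoint_left]
  intro x hx
  simp at hx
  rcases hx with rfl | rfl <;> simp

lemma pop_eq (d k m : ℕ) (h0 : 0 < k) (hd : 0 < d) (θ : Fin m → ℝ)
    (φ : Matrix (Fin d) (Fin m) ℝ) (μ : ℝ)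
    (h : ∀ x, qnet θ φ x = μ * (x ⟨0, hd⟩) ^ 2) :
    popLoss (sourceMeasure d k) θ φ = 2 / 3 * (μ - 1) ^ 2 := by
  have i0 : ∀ i : Fin d, IsProbabilityMeasure
      (if (i : ℕ) < k then Measure.dirac (0 : ℝ) else unif3) := by
    intro i; split_ifs <;> infer_instance
  have i1 : ∀ i : Fin d, IsProbabilityMeasure
      (if (i : ℕ) < k then unif2 else unif3) := by
    intro i; split_ifs <;> infer_instance
  have p0 : IsProbabilityMeasure (srcBranch0 d k) := by unfold srcBranch0; infer_instance
  have p1 : IsProbabilityMeasure (srcBranch1 d k) := by unfold srcBranch1; infer_instance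
  have a0 : ∀ᵐ x ∂(srcBranch0 d k), x ⟨0, hd⟩ = 0 := by
    have := Measure.tendsto_eval_ae_ae (μ := fun i : Fin d =>
      (if (i : ℕ) < k then Measure.dirac (0 : ℝ) else unif3)) (i := ⟨0, hd⟩)
    refine this.eventually (p := fun y : ℝ => y = 0) ?_
    simp [h0]
  have a1 : ∀ᵐ x ∂(srcBranch1 d k), (x ⟨0, hd⟩) ^ 2 = 1 := by
    have := Measure.tendsto_eval_ae_ae (μ := fun i : Fin d =>
      (if (i : ℕ) < k then unif2 else unif3)) (i := ⟨0, hd⟩)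
    refine this.eventually (p := fun y : ℝ => y ^ 2 = 1) ?_
    simp only [h0, if_true]
    exact unif2_ae
  unfold popLoss
  simp only [h]
  have m0 : Measurable (fun x : Fin d → ℝ => (x, (0 : ℝ))) := by fun_prop
  have m1 : Measurable (fun x : Fin d → ℝ => (x, (1 : ℝ))) := by fun_prop
  have mF : Measurable (fun p : (Fin d → ℝ) × ℝ => (μ * p.1 ⟨0, hd⟩ ^ 2 - p.2) ^ 2) := by fun_prop
  have e0 : (fun p : (Fin d → ℝ) × ℝ => (μ * p.1 ⟨0, hd⟩ ^ 2 - p.2) ^ 2)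
      =ᵐ[(srcBranch0 d k).map (fun x => (x, (0 : ℝ)))] fun _ => 0 := by
    refine (ae_map_iff m0.aemeasurable (measurableSet_eq_fun mF measurable_const)).2 ?_
    filter_upwards [a0] with x hx
    simp [hx]
  have e1 : (fun p : (Fin d → ℝ) × ℝ => (μ * p.1 ⟨0, hd⟩ ^ 2 - p.2) ^ 2)
      =ᵐ[(srcBranch1 d k).map (fun x => (x, (1 : ℝ)))] fun _ => (μ - 1) ^ 2 := by
    refine (ae_map_iff m1.aemeasurable (measurableSet_eq_fun mF measurable_const)).2 ?_
    filter_upwards [a1] with x hx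
    simp [hx]
  have q1 := Measure.isProbabilityMeasure_map (μ := srcBranch1 d k) m1.aemeasurable
  have q0 := Measure.isProbabilityMeasure_map (μ := srcBranch0 d k) m0.aemeasurable
  unfold sourceMeasure
  rw [integral_add_measure, integral_smul_measure, integral_smul_measure,
    integral_congr_ae e0, integral_congr_ae e1]
  · simp
  · exact ((integrable_const _).congr e0.symm).smul_measure (by
      simp [ENNReal.div_eq_top])
  · exact ((integrable_const _).congr e1.symm).smul_measure (by
      simp [ENNReal.div_eq_top])

lemma aux_min (c e : ℝ) (hc : 0 ≤ c) (he : 0 ≤ e) :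
    ∃ μ₀ : ℝ, c * |μ₀| ^ ((2 : ℝ) / 3) + e * (μ₀ - 1) ^ 2 ≤
      sInf (Set.range fun μ : ℝ => c * |μ| ^ ((2 : ℝ) / 3) + e * (μ - 1) ^ 2) := by
  have hcont : Continuous fun μ : ℝ => c * |μ| ^ ((2 : ℝ) / 3) + e * (μ - 1) ^ 2 := by
    have : Continuous fun μ : ℝ => |μ| ^ ((2 : ℝ) / 3) :=
      continuous_abs.rpow_const (fun _ => Or.inr (by norm_num))
    fun_prop
  obtain ⟨μ₀, -, h⟩ := (isCompact_Icc (a := (0 : ℝ)) (b := 2)).exists_isMinOn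
    ⟨0, by norm_num⟩ hcont.continuousOn
  refine ⟨μ₀, le_csInf (Set.range_nonempty _) ?_⟩
  rintro _ ⟨μ, rfl⟩
  by_cases hμ : μ ∈ Set.Icc (0 : ℝ) 2
  · exact h hμ
  · refine le_trans (h (show (0 : ℝ) ∈ Set.Icc (0 : ℝ) 2 by norm_num)) ?_
    have h1 : 1 ≤ (μ - 1) ^ 2 := by
      by_contra! hh
      apply hμ
      have := (sq_lt_one_iff_abs_lt_one (μ - 1)).1 hh
      rw [abs_lt] at this
      constructor <;> linarith [this.1, this.2]
    have h2 : 0 ≤ c * |μ| ^ ((2 : ℝ) / 3) := by positivity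
    have h3 : c * |(0 : ℝ)| ^ ((2 : ℝ) / 3) = 0 := by
      rw [abs_zero, Real.zero_rpow (by norm_num), mul_zero]
    simp only [h3]
    nlinarith

/-- Lemma 2: if the target labels are `y_i = (x_i)_{[1]}²` and there exists a vector `φ̂_t`
with `⟨φ̂_t, x_i⟩ = (x_i)_{[1]}` for all target samples, then there is a solution whose joint
training objective is at most
`min_μ [ (3λ/2^{2/3})|μ|^{2/3} + (2/3)(1-α)(μ-1)² ] + (3λ/2^{2/3})‖φ̂_t‖₂^{4/3}`. -/
theorem jointObj_upper_bound (d k m nt : ℕ) (h2 : 2 ≤ k) (hkd : k ≤ d) (hm : 2 ≤ m)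
    (α lam : ℝ) (hα0 : 0 < α) (hα1 : α < 1) (hlam : 0 < lam)
    (S : Fin nt → (Fin d → ℝ) × ℝ)
    (hy : ∀ i : Fin nt, (S i).2 = ((S i).1 ⟨0, by omega⟩) ^ 2)
    (φt : Fin d → ℝ)
    (hφt : ∀ i : Fin nt, ∑ j, φt j * (S i).1 j = (S i).1 ⟨0, by omega⟩) :
    ∃ (θs θt : Fin m → ℝ) (φ : Matrix (Fin d) (Fin m) ℝ),
      jointObj k α lam S θs θt φ ≤
        sInf (Set.range fun μ : ℝ =>
            (3 * lam / (2 : ℝ) ^ ((2 : ℝ) / 3)) * |μ| ^ ((2 : ℝ) / 3)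
              + (2 / 3) * (1 - α) * (μ - 1) ^ 2)
          + (3 * lam / (2 : ℝ) ^ ((2 : ℝ) / 3))
              * (Real.sqrt (∑ j, (φt j) ^ 2)) ^ ((4 : ℝ) / 3) := by
  obtain ⟨μ, hμ⟩ := aux_min (3 * lam / (2 : ℝ) ^ ((2 : ℝ) / 3)) (2 / 3 * (1 - α))
    (by positivity) (by linarith)
  obtain ⟨θ₁, a, h1, h1c⟩ := aux_cost μ
  have hN0 : 0 ≤ ∑ j, (φt j) ^ 2 := Finset.sum_nonneg fun _ _ => sq_nonneg _
  have hcost : ∃ θ₂ c : ℝ, (∀ i : Fin nt, θ₂ * c ^ 2 * ((S i).1 ⟨0, by omega⟩) ^ 2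
        = ((S i).1 ⟨0, by omega⟩) ^ 2) ∧
      θ₂ ^ 2 + c ^ 2 * ∑ j, (φt j) ^ 2 = 3 / (2 : ℝ) ^ ((2 : ℝ) / 3)
        * (Real.sqrt (∑ j, (φt j) ^ 2)) ^ ((4 : ℝ) / 3) := by
    have hp : (Real.sqrt (∑ j, (φt j) ^ 2)) ^ ((4 : ℝ) / 3)
        = |∑ j, (φt j) ^ 2| ^ ((2 : ℝ) / 3) := by
      rw [abs_of_nonneg hN0, Real.sqrt_eq_rpow, ← Real.rpow_mul hN0]; norm_num
    rw [hp]
    obtain ⟨θ₂, b, hb, hbc⟩ := aux_cost (∑ j, (φt j) ^ 2)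
    rcases hN0.eq_or_lt with hz | hpos
    · refine ⟨0, 0, ?_, ?_⟩
      · intro i
        have hj : ∀ j, φt j = 0 := by
          intro j
          have := (Finset.sum_eq_zero_iff_of_nonneg (fun j _ => sq_nonneg (φt j))).1 hz.symm j
            (Finset.mem_univ j)
          exact pow_eq_zero_iff (two_ne_zero) |>.1 this
        rw [← hφt i]
        simp [hj]
      · rw [← hz, abs_zero, Real.zero_rpow (by norm_num)]; simp
    · have hs : Real.sqrt (∑ j, (φt j) ^ 2) ^ 2 = ∑ j, (φt j) ^ 2 := Real.sq_sqrt hN0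
      refine ⟨θ₂, b / Real.sqrt (∑ j, (φt j) ^ 2), ?_, ?_⟩
      · intro i
        have : θ₂ * (b / Real.sqrt (∑ j, (φt j) ^ 2)) ^ 2 = 1 := by
          rw [div_pow, hs, ← mul_div_assoc, hb, div_self hpos.ne']
        rw [this, one_mul]
      · rw [div_pow, hs, div_mul_cancel₀ _ hpos.ne', hbc]
  obtain ⟨θ₂, c, h2, h2c⟩ := hcost
  set j0 : Fin d := ⟨0, by omega⟩ with hj0
  set i0 : Fin m := ⟨0, by omega⟩ with hi0
  set i1 : Fin m := ⟨1, by omega⟩ with hi1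
  have hne : i1 ≠ i0 := by simp [hi0, hi1]
  set φ : Matrix (Fin d) (Fin m) ℝ := fun j i =>
    (if i = i0 then (if j = j0 then a else 0) else 0) + (if i = i1 then c * φt j else 0) with hφ
  have c0 : ∀ j, φ j i0 = if j = j0 then a else 0 := by
    intro j; simp [hφ, hne.symm]
  have c1 : ∀ j, φ j i1 = c * φt j := by
    intro j; simp [hφ, hne]
  refine ⟨fun i => if i = i0 then θ₁ else 0, fun i => if i = i1 then θ₂ else 0, φ, ?_⟩
  have hpop := pop_eq d k m (by omega) (by omega) (fun i => if i = i0 then θ₁ else 0) φ μ (by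
    intro x
    simp only [qnet, ite_mul, zero_mul, Finset.sum_ite_eq', Finset.mem_univ, if_true, c0]
    rw [← h1]; ring)
  have hemp : empLoss S (fun i => if i = i1 then θ₂ else 0) φ = 0 := by
    unfold empLoss
    rw [Finset.sum_eq_zero, mul_zero]
    intro i _
    have : qnet (fun i => if i = i1 then θ₂ else 0) φ (S i).1 = (S i).2 := by
      simp only [qnet, ite_mul, zero_mul, Finset.sum_ite_eq', Finset.mem_univ, if_true, c1]
      rw [hy i, ← h2 i, ← hφt i]
      simp only [mul_assoc, ← Finset.mul_sum]
      ring
    rw [this]; simp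
  have hn1 : normSq (fun i => if i = i0 then θ₁ else 0) = θ₁ ^ 2 := by
    simp [normSq]
  have hn2 : normSq (fun i => if i = i1 then θ₂ else 0) = θ₂ ^ 2 := by
    simp [normSq]
  have hfr : frobSq φ = a ^ 2 + c ^ 2 * ∑ j, (φt j) ^ 2 := by
    have : ∀ j i, (φ j i) ^ 2 = (if i = i0 then (if j = j0 then a ^ 2 else 0) else 0)
        + (if i = i1 then c ^ 2 * φt j ^ 2 else 0) := by
      intro j i
      by_cases e0 : i = i0
      · subst e0; rw [c0]; simp [hne.symm]
      · by_cases e1 : i = i1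
        · subst e1; rw [c1]; simp [hne]; ring
        · simp [hφ, e0, e1]
    simp only [frobSq, this, Finset.sum_add_distrib, Finset.sum_ite_eq', Finset.mem_univ, if_true,
      Finset.mul_sum]
  unfold jointObj
  rw [hpop, hemp, hn1, hn2, hfr]
  refine le_trans (le_of_eq ?_) (add_le_add_left hμ _)
  rw [mul_div_right_comm, mul_comm _ lam] at *
  linear_combination lam * h1c + lam * h2c
end

section
/- Let d ≥ 2 and let j be an integer with 2 ≤ j ≤ d. For every γ ∈ ℝ, the target population squared loss of the predictor x ↦ γ·x_{[j]}^2 satisfies E_{(x,y)∼D_t}[(γ·x_{[j]}^2 − y)^2] = (2/3)·γ^2 − (8/9)·γ + 2/3, and this quantity is at least 10/27 for all γ ∈ ℝ. -/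
open MeasureTheory Finset

lemma unif3_eq : unif3 = (3⁻¹ : ENNReal) • (Measure.dirac (-1:ℝ) + Measure.dirac 0 + Measure.dirac 1) := by
  ext s hs
  rw [unif3, PMF.toMeasure_uniformOfFinset_apply _ _ hs]
  simp only [Measure.smul_apply, Measure.add_apply, Measure.dirac_apply' _ hs, Set.indicator, smul_eq_mul]
  have hc : ({-1, 0, 1} : Finset ℝ).card = 3 := by
    rw [Finset.card_insert_of_notMem, Finset.card_insert_of_notMem] <;> norm_num
  rw [hc, Finset.card_filter, Finset.sum_insert (by norm_num), Finset.sum_insert (by norm_num), Finset.sum_singleton]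
  rw [ENNReal.div_eq_inv_mul]
  push_cast
  simp [add_assoc]

lemma unif3_prob_s13 : IsProbabilityMeasure unif3 := by unfold unif3; infer_instance
lemma unif2_prob_s13 : IsProbabilityMeasure unif2 := by unfold unif2; infer_instance

lemma unif3_integrable (f : ℝ → ℝ) : Integrable f unif3 := by
  rw [unif3_eq]
  have h (a : ℝ) : Integrable f (Measure.dirac a) := integrable_dirac (by simp)
  exact (((h _).add_measure (h _)).add_measure (h _)).smul_measure (by simp)

lemma unif3_integral (f : ℝ → ℝ) : ∫ x, f x ∂unif3 = (f (-1) + f 0 + f 1) / 3 := by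
  rw [unif3_eq]
  have h (a : ℝ) : Integrable f (Measure.dirac a) := integrable_dirac (by simp)
  rw [integral_smul_measure, integral_add_measure ((h _).add_measure (h _)) (h _),
    integral_add_measure (h _) (h _)]
  simp
  ring

lemma branch_aux {d : ℕ} (μ : Fin d → Measure ℝ) [∀ i, IsProbabilityMeasure (μ i)] (j : Fin d)
    (hj : μ j = unif3) (c γ : ℝ) :
    Integrable (fun p : (Fin d → ℝ) × ℝ => (γ * (p.1 j) ^ 2 - p.2) ^ 2)
      ((Measure.pi μ).map (fun x => (x, c))) ∧
    ∫ p, (γ * (p.1 j) ^ 2 - p.2) ^ 2 ∂((Measure.pi μ).map (fun x => (x, c)))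
      = (2 * (γ - c) ^ 2 + c ^ 2) / 3 := by
  have hm : Measurable (fun x : Fin d → ℝ => (x, c)) := by fun_prop
  have hf : Measurable (fun p : (Fin d → ℝ) × ℝ => (γ * (p.1 j) ^ 2 - p.2) ^ 2) := by fun_prop
  have hp := measurePreserving_eval μ j
  rw [hj] at hp
  have hg : Measurable (fun t : ℝ => (γ * t ^ 2 - c) ^ 2) := by fun_prop
  constructor
  · rw [integrable_map_measure hf.aestronglyMeasurable hm.aemeasurable]
    exact hp.integrable_comp_of_integrable (unif3_integrable (fun t : ℝ => (γ * t ^ 2 - c) ^ 2))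
  · rw [integral_map hm.aemeasurable hf.aestronglyMeasurable]
    have := unif3_integral (fun t : ℝ => (γ * t ^ 2 - c) ^ 2)
    rw [← hp.map_eq, integral_map hp.measurable.aemeasurable hg.aestronglyMeasurable] at this
    simp only [Function.eval] at this
    rw [this]
    ring

/-- The target loss of the source-specific predictor `x ↦ γ x_{[j]}²` for `j ≥ 2` equals
`(2/3)γ² - (8/9)γ + 2/3 ≥ 10/27`. (0-based coordinates: `1 ≤ (j : ℕ)` corresponds to
the paper's `j ∈ {2, …, d}`.) -/
theorem source_specific_predictor_loss (d : ℕ) (hd : 2 ≤ d) (j : Fin d)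
    (hj : 1 ≤ (j : ℕ)) (γ : ℝ) :
    (∫ p, (γ * (p.1 j) ^ 2 - p.2) ^ 2 ∂(targetMeasure d))
        = (2 / 3) * γ ^ 2 - (8 / 9) * γ + 2 / 3
      ∧ (10 / 27 : ℝ) ≤ (2 / 3) * γ ^ 2 - (8 / 9) * γ + 2 / 3 := by
  refine ⟨?_, by nlinarith [sq_nonneg (γ - 2 / 3)]⟩
  haveI := unif3_prob_s13
  haveI := unif2_prob_s13
  have hj' : ¬ (j : ℕ) < 1 := by omega
  haveI : ∀ i : Fin d, IsProbabilityMeasure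
      (if (i : ℕ) < 1 then Measure.dirac (0 : ℝ) else unif3) := by
    intro i; split_ifs <;> infer_instance
  haveI : ∀ i : Fin d, IsProbabilityMeasure (if (i : ℕ) < 1 then unif2 else unif3) := by
    intro i; split_ifs <;> infer_instance
  obtain ⟨a0, b0⟩ := branch_aux
    (fun i : Fin d => if (i : ℕ) < 1 then Measure.dirac (0 : ℝ) else unif3) j (if_neg hj') 0 γ
  obtain ⟨a1, b1⟩ := branch_aux
    (fun i : Fin d => if (i : ℕ) < 1 then unif2 else unif3) j (if_neg hj') 1 γ
  unfold targetMeasure sourceMeasure srcBranch0 srcBranch1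
  rw [integral_add_measure (a0.smul_measure (ENNReal.div_ne_top (by simp) (by simp)))
    (a1.smul_measure (ENNReal.div_ne_top (by simp) (by simp))),
    integral_smul_measure, integral_smul_measure, b0, b1]
  simp only [ENNReal.toReal_div, smul_eq_mul, ENNReal.toReal_one, ENNReal.toReal_ofNat]
  ring
end
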